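/- Let ~ be a homogeneous word relation. Then the subspace K^(~) ⊆ W is a graded sub-bialgebra of W — that is, [∅,0] ∈ K^(~), ∇⧢(x ⊗ y) ∈ K^(~) for all x, y ∈ K^(~), and Δ⊙(K^(~)) ⊆ K^(~) ⊗ K^(~) (viewed inside W ⊗ W) — if and only if ~ is algebraic. -/

import Mathlib

abbrev Word : Type := List ℕ+

def maxLetter (w : Word) : ℕ := w.foldr (fun a n => max (a : ℕ) n) 0

open Classical in
noncomputable def wRestrict (w : Word) (S : Set ℕ+) : Word :=
  w.filter fun a => decide (a ∈ S)

def wUp (m : ℕ) (w : Word) : Word :=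
  w.map fun (a : ℕ+) => ⟨(a : ℕ) + m, Nat.add_pos_left a.pos m⟩

open scoped TensorProduct

/-- The basis set `𝕎`: pairs `[w,n]` with `max(w) ≤ n`. -/
def WIdx : Type := {p : Word × ℕ // ∀ a ∈ p.1, (a : ℕ) ≤ p.2}

/-- `W`: the free `k`-vector space on `𝕎`. -/
abbrev WSpace (k : Type*) [Field k] : Type _ := WIdx →₀ k

variable (k : Type*) [Field k]

/-- `u` is a shuffle of `v` and `w ↑ m`:
`u ∩ {1,…,m} = v`, `u ∩ {m+1,…,m+n} = w ↑ m` and `ℓ(u) = ℓ(v) + ℓ(w)`. -/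
def IsShuffle (m n : ℕ) (v w u : Word) : Prop :=
  wRestrict u {a : ℕ+ | (a : ℕ) ≤ m} = v ∧
  wRestrict u {a : ℕ+ | m < (a : ℕ) ∧ (a : ℕ) ≤ m + n} = wUp m w ∧
  u.length = v.length + w.length

/-- `∇⧢([v,m] ⊗ [w,n]) = Σ_u [u, m+n]` over all shuffles `u` of `v` and `w ↑ m`. -/
noncomputable def shufProd (p q : WIdx) : WSpace k :=
  ∑ᶠ (u : WIdx) (_ : u.1.2 = p.1.2 + q.1.2 ∧ IsShuffle p.1.2 q.1.2 p.1.1 q.1.1 u.1.1),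
    Finsupp.single u 1

/-- The shifted shuffle product `∇⧢` as a bilinear map. -/
noncomputable def mulW : WSpace k →ₗ[k] WSpace k →ₗ[k] WSpace k :=
  Finsupp.lift (WSpace k →ₗ[k] WSpace k) k WIdx fun p =>
    Finsupp.lift (WSpace k) k WIdx fun q => shufProd k p q

/-- `Δ⊙([w,n]) = Σ_i [w₁⋯wᵢ, n] ⊗ [wᵢ₊₁⋯, n]`, on a basis element. -/
noncomputable def deconc (p : WIdx) : WSpace k ⊗[k] WSpace k :=
  ∑ i ∈ Finset.range (p.1.1.length + 1),
    (Finsupp.single (⟨(p.1.1.take i, p.1.2),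
        fun a ha => p.2 a (List.take_subset i p.1.1 ha)⟩ : WIdx) (1 : k)) ⊗ₜ[k]
    (Finsupp.single (⟨(p.1.1.drop i, p.1.2),
        fun a ha => p.2 a (List.drop_subset i p.1.1 ha)⟩ : WIdx) (1 : k))

/-- The deconcatenation coproduct `Δ⊙`. -/
noncomputable def comulW : WSpace k →ₗ[k] WSpace k ⊗[k] WSpace k :=
  Finsupp.lift (WSpace k ⊗[k] WSpace k) k WIdx (deconc k)

/-- The unit element `[∅, 0]`. -/
noncomputable def unitW : WSpace k :=
  Finsupp.single ⟨(([] : Word), 0), by intro a ha; simp at ha⟩ 1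

/-- The counit `ε`. -/
noncomputable def counitW : WSpace k →ₗ[k] k :=
  Finsupp.lift k k WIdx fun p => if p.1.1 = [] then 1 else 0

/-- The degree-`d` homogeneous component of `W` (spanned by basis elements
`[w,n]` with `ℓ(w) = d`). -/
noncomputable def Wdeg (d : ℕ) : Submodule k (WSpace k) :=
  Submodule.span k {f : WSpace k | ∃ p : WIdx, p.1.1.length = d ∧ f = Finsupp.single p 1}


def wDown (m : ℕ) (w : Word) : Word :=
  w.filterMap fun (a : ℕ+) =>
    if h : m < (a : ℕ) then some ⟨(a : ℕ) - m, Nat.sub_pos_of_lt h⟩ else none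

/-- Two words have the same set of letters. -/
def SameLetters (v w : Word) : Prop := v.toFinset = w.toFinset

/-- A word relation: an equivalence relation on words such that related words
have the same set of letters. -/
structure IsWordRel (r : Word → Word → Prop) : Prop where
  equiv : Equivalence r
  letters : ∀ v w, r v w → SameLetters v w

/-- `(w ∩ I) ↓ m` for the interval `I = {m+1, ..., n}`. -/
noncomputable def intervalDown (m n : ℕ) (w : Word) : Word :=
  wDown m (wRestrict w {a : ℕ+ | m < (a : ℕ) ∧ (a : ℕ) ≤ n})

/-- An algebraic word relation. -/
structure IsAlgebraicRel (r : Word → Word → Prop) extends IsWordRel r : Prop where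
  concat : ∀ v v' w w', r v v' → r w w' → r (v ++ w) (v' ++ w')
  restrict : ∀ v w, r v w → ∀ m n : ℕ, r (intervalDown m n v) (intervalDown m n w)

/-- A homogeneous word relation relates only words of the same length. -/
def IsHomogeneous (r : Word → Word → Prop) : Prop :=
  ∀ v w, r v w → v.length = w.length

variable {k}

/-- `κ_E^n = Σ_{w ∈ E} [w,n]`, for `E` the `r`-equivalence class of `w₀`. -/
noncomputable def kappa (r : Word → Word → Prop) (n : ℕ) (w₀ : Word) : WSpace k :=
  ∑ᶠ (p : WIdx) (_ : p.1.2 = n ∧ r p.1.1 w₀), Finsupp.single p 1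

variable (k)

/-- `K^(~)`: the span of the class sums `κ_E^n`. -/
noncomputable def Krel (r : Word → Word → Prop) : Submodule k (WSpace k) :=
  Submodule.span k {f : WSpace k | ∃ (n : ℕ) (w₀ : Word),
    (∀ a ∈ w₀, (a : ℕ) ≤ n) ∧ f = kappa r n w₀}

theorem wRestrict_cons_of_mem {S : Set ℕ+} {a : ℕ+} (h : a ∈ S) (w : Word) :
    wRestrict (a :: w) S = a :: wRestrict w S := by
  simp [wRestrict, h]

theorem wRestrict_cons_of_notMem {S : Set ℕ+} {a : ℕ+} (h : a ∉ S) (w : Word) :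
    wRestrict (a :: w) S = wRestrict w S := by
  simp [wRestrict, h]

theorem mem_wRestrict {S : Set ℕ+} {a : ℕ+} {w : Word} :
    a ∈ wRestrict w S ↔ a ∈ w ∧ a ∈ S := by
  simp [wRestrict]

theorem wUp_cons {m : ℕ} {a b : ℕ+} (h : (b : ℕ) = a + m) (w : Word) :
    wUp m (a :: w) = b :: wUp m w :=
  congrArg (· :: wUp m w) (PNat.eq h.symm)

theorem wDown_cons {m : ℕ} {a b : ℕ+} (h : (a : ℕ) = b + m) (w : Word) :
    wDown m (a :: w) = b :: wDown m w := by
  have ha : m < (a : ℕ) := h ▸ Nat.lt_add_of_pos_left b.pos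
  refine List.filterMap_cons_some ?_
  rw [dif_pos ha]
  exact congrArg some (PNat.eq (Nat.sub_eq_of_eq_add h))

theorem length_wUp (m : ℕ) (w : Word) : (wUp m w).length = w.length :=
  List.length_map _

theorem wDown_wUp (m : ℕ) (w : Word) : wDown m (wUp m w) = w := by
  induction w with
  | nil => rfl
  | cons a w ih =>
    obtain ⟨b, hb⟩ : ∃ b : ℕ+, (b : ℕ) = a + m := ⟨⟨a + m, Nat.add_pos_left a.pos m⟩, rfl⟩
    rw [wUp_cons hb, wDown_cons hb, ih]

theorem wUp_wDown {m : ℕ} {w : Word} (h : ∀ a ∈ w, m < (a : ℕ)) : wUp m (wDown m w) = w := by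
  induction w with
  | nil => rfl
  | cons a w ih =>
    have ha : m < (a : ℕ) := h a (by simp)
    obtain ⟨b, hb⟩ : ∃ b : ℕ+, (a : ℕ) = b + m :=
      ⟨⟨a - m, Nat.sub_pos_of_lt ha⟩, (Nat.sub_add_cancel ha.le).symm⟩
    rw [wDown_cons hb, wUp_cons hb, ih fun c hc => h c (by simp [hc])]

theorem wDown_zero (w : Word) : wDown 0 w = w := by
  induction w with
  | nil => rfl
  | cons a w ih => rw [wDown_cons (b := a) rfl, ih]

theorem intervalDown_zero (n : ℕ) (w : Word) :
    intervalDown 0 n w = wRestrict w {a : ℕ+ | (a : ℕ) ≤ n} := by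
  rw [intervalDown, wDown_zero]
  congr 1
  ext a
  simp

theorem mem_intervalDown_le {m n : ℕ} {w : Word} {a : ℕ+} (h : a ∈ intervalDown m n w) :
    (a : ℕ) ≤ n - m := by
  simp only [intervalDown, wDown, List.mem_filterMap, mem_wRestrict, Set.mem_ofPred_eq] at h
  obtain ⟨b, ⟨-, hb, hbn⟩, h⟩ := h
  rw [dif_pos hb] at h
  have hab : (b : ℕ) - m = a := congrArg PNat.val (Option.some.inj h)
  omega

theorem intervalDown_eq_nil_of_le {m n : ℕ} (h : n ≤ m) (w : Word) : intervalDown m n w = [] := by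
  refine List.eq_nil_iff_forall_not_mem.2 fun a ha => ?_
  have := mem_intervalDown_le ha
  have := a.pos
  omega

theorem intervalDown_intervalDown_zero (m n : ℕ) (w : Word) :
    intervalDown m n (intervalDown 0 n w) = intervalDown m n w := by
  rw [intervalDown_zero, intervalDown, intervalDown]
  congr 1
  simp only [wRestrict, List.filter_filter]
  refine List.filter_congr fun a _ => ?_
  simp only [Set.mem_ofPred_eq, ← Bool.decide_and]
  exact decide_eq_decide.2 (by omega)

theorem length_wRestrict_add {m N : ℕ} {u : Word} (h : ∀ a ∈ u, (a : ℕ) ≤ N) :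
    (wRestrict u {a : ℕ+ | (a : ℕ) ≤ m}).length +
      (wRestrict u {a : ℕ+ | m < (a : ℕ) ∧ (a : ℕ) ≤ N}).length = u.length := by
  induction u with
  | nil => rfl
  | cons a u ih =>
    have ih := ih fun b hb => h b (by simp [hb])
    have ha := h a (by simp)
    by_cases ham : (a : ℕ) ≤ m
    · rw [wRestrict_cons_of_mem (by simpa using ham),
        wRestrict_cons_of_notMem (by simp; omega)]
      simp only [List.length_cons]
      omega
    · rw [wRestrict_cons_of_notMem (by simpa using ham),
        wRestrict_cons_of_mem (by simp; omega)]
      simp only [List.length_cons]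
      omega

theorem isShuffle_iff {m n : ℕ} {v w u : Word} (h : ∀ a ∈ u, (a : ℕ) ≤ m + n) :
    IsShuffle m n v w u ↔ intervalDown 0 m u = v ∧ intervalDown m (m + n) u = w := by
  have hlen := length_wRestrict_add (m := m) h
  rw [IsShuffle, intervalDown_zero, intervalDown]
  constructor
  · rintro ⟨h1, h2, -⟩
    exact ⟨h1, by rw [h2, wDown_wUp]⟩
  · rintro ⟨rfl, h2⟩
    have h3 : wRestrict u {a : ℕ+ | m < (a : ℕ) ∧ (a : ℕ) ≤ m + n} = wUp m w := by
      rw [← h2, wUp_wDown]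
      exact fun a ha => (mem_wRestrict.1 ha).2.1
    refine ⟨rfl, h3, ?_⟩
    rw [← hlen, h3, length_wUp]

/-- The element `[w, n]` of `𝕎`. -/
def mkIdx (w : Word) (n : ℕ) (h : ∀ a ∈ w, (a : ℕ) ≤ n) : WIdx := ⟨(w, n), h⟩

theorem idx_ext {p q : WIdx} (h : p.1.1 = q.1.1) (h' : p.1.2 = q.1.2) : p = q :=
  Subtype.ext (Prod.ext h h')

theorem finite_setOf_length_eq (n l : ℕ) :
    {p : WIdx | p.1.2 = n ∧ p.1.1.length = l}.Finite := by
  have : Finite {a : ℕ+ // (a : ℕ) ≤ n} := by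
    refine Finite.of_injective (fun a => (⟨(a.1 : ℕ), Nat.lt_succ_of_le a.2⟩ : Fin (n + 1))) ?_
    intro a b hab
    exact Subtype.ext (PNat.eq (by simpa using hab))
  refine Set.Finite.of_finite_image (f := Subtype.val)
    (((List.finite_length_eq {a : ℕ+ // (a : ℕ) ≤ n} l).image
      fun w => (w.map Subtype.val, n)).subset ?_) Subtype.val_injective.injOn
  rintro _ ⟨⟨⟨w, N⟩, hw⟩, ⟨rfl, rfl⟩, rfl⟩
  refine ⟨w.attach.map fun a => ⟨a.1, hw a.1 a.2⟩, by simp, ?_⟩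
  simp [List.map_map, Function.comp_def]

open Classical in
theorem finsum_single_apply {α : Type*} {P : α → Prop} (h : {p | P p}.Finite) (q : α) :
    (∑ᶠ (p : α) (_ : P p), Finsupp.single p (1 : k)) q = if P q then 1 else 0 := by
  have := finsum_mem_eq_finite_toFinset_sum (fun p => Finsupp.single p (1 : k)) h
  simp only [Set.mem_ofPred_eq] at this
  rw [this, Finsupp.finsetSum_apply]
  simp [Finsupp.single_apply]

/-- A finitely supported function that is constant on the classes of an equivalence relation
is a linear combination of the indicator functions of the classes. -/
theorem mem_span_range_of_invariant {α : Type*} {R : α → α → Prop} (hR : Equivalence R)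
    {c : α → α →₀ k} (hc : ∀ a p, R p a → c a p = 1) (hc' : ∀ a p, ¬ R p a → c a p = 0)
    (x : α →₀ k) (hx : ∀ p q, R p q → x p = x q) : x ∈ Submodule.span k (Set.range c) := by
  induction hn : x.support.card using Nat.strong_induction_on generalizing x with
  | _ n ih =>
    by_cases h0 : x = 0
    · rw [h0]
      exact zero_mem _
    obtain ⟨a, ha⟩ := Finsupp.support_nonempty_iff.2 h0
    set y := x - x a • c a with hy
    have hya : ∀ p, R p a → y p = 0 := fun p hp => by
      simp [hy, hc a p hp, hx p a hp]
    have hyn : ∀ p, ¬ R p a → y p = x p := fun p hp => by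
      simp [hy, hc' a p hp]
    have hlt : y.support.card < n := by
      rw [← hn]
      refine Finset.card_lt_card ⟨fun p hp => ?_, fun hsub => ?_⟩
      · rw [Finsupp.mem_support_iff] at hp ⊢
        by_cases hpa : R p a
        · exact absurd (hya p hpa) hp
        · rwa [← hyn p hpa]
      · exact Finsupp.mem_support_iff.1 (hsub ha) (hya a (hR.refl a))
    have hmem := ih _ hlt y (fun p q hpq => by
      by_cases hq : R q a
      · rw [hya q hq, hya p (hR.trans hpq hq)]
      · rw [hyn q hq, hyn p fun hp => hq (hR.trans (hR.symm hpq) hp), hx p q hpq]) rfl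
    have hxy : x = y + x a • c a := by simp [hy]
    rw [hxy]
    exact add_mem hmem (Submodule.smul_mem _ _ (Submodule.subset_span ⟨a, rfl⟩))

/-- The relation on `𝕎` induced by a relation on words. -/
def idxRel (r : Word → Word → Prop) (p q : WIdx) : Prop := p.1.2 = q.1.2 ∧ r p.1.1 q.1.1

theorem idxRel_equivalence {r : Word → Word → Prop} (hr : Equivalence r) :
    Equivalence (idxRel r) where
  refl _ := ⟨rfl, hr.refl _⟩
  symm h := ⟨h.1.symm, hr.symm h.2⟩
  trans h h' := ⟨h.1.trans h'.1, hr.trans h.2 h'.2⟩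

theorem prod_idxRel_equivalence {r : Word → Word → Prop} (hr : Equivalence r) :
    Equivalence fun s t : WIdx × WIdx => idxRel r s.1 t.1 ∧ idxRel r s.2 t.2 where
  refl _ := ⟨(idxRel_equivalence hr).refl _, (idxRel_equivalence hr).refl _⟩
  symm h := ⟨(idxRel_equivalence hr).symm h.1, (idxRel_equivalence hr).symm h.2⟩
  trans h h' := ⟨(idxRel_equivalence hr).trans h.1 h'.1, (idxRel_equivalence hr).trans h.2 h'.2⟩

open Classical in
theorem kappa_apply {r : Word → Word → Prop} (hhom : IsHomogeneous r) (n : ℕ) (w : Word)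
    (p : WIdx) : kappa r n w p = if p.1.2 = n ∧ r p.1.1 w then (1 : k) else 0 := by
  rw [kappa, finsum_single_apply k (P := fun p : WIdx => p.1.2 = n ∧ r p.1.1 w)
    ((finite_setOf_length_eq n w.length).subset fun _ hp => ⟨hp.1, hhom _ _ hp.2⟩) p]
  congr

theorem kappa_mem_Krel (r : Word → Word → Prop) {n : ℕ} {w : Word} (h : ∀ a ∈ w, (a : ℕ) ≤ n) :
    kappa r n w ∈ Krel k r :=
  Submodule.subset_span ⟨n, w, h, rfl⟩

theorem mem_Krel_iff {r : Word → Word → Prop} (hr : Equivalence r) (hhom : IsHomogeneous r)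
    {x : WSpace k} : x ∈ Krel k r ↔ ∀ p q, idxRel r p q → x p = x q := by
  classical
  constructor
  · intro hx p q hpq
    induction hx using Submodule.span_induction with
    | mem x hx =>
      obtain ⟨n, w, -, rfl⟩ := hx
      rw [kappa_apply k hhom, kappa_apply k hhom, hpq.1]
      have : r p.1.1 w ↔ r q.1.1 w := ⟨hr.trans (hr.symm hpq.2), hr.trans hpq.2⟩
      rw [this]
    | zero => rfl
    | add x y _ _ hx hy => simp [hx, hy]
    | smul c x _ hx => simp [hx]
  · intro hx
    refine Submodule.span_mono ?_ (mem_span_range_of_invariant k (idxRel_equivalence hr)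
      (c := fun p => kappa r p.1.2 p.1.1)
      (fun a p h => by rw [kappa_apply k hhom]; exact if_pos h)
      (fun a p h => by rw [kappa_apply k hhom]; exact if_neg h) x hx)
    rintro _ ⟨p, rfl⟩
    exact ⟨_, _, p.2, rfl⟩

theorem mem_Krel_tensor_iff {r : Word → Word → Prop} (hr : Equivalence r)
    (hhom : IsHomogeneous r) {t : WSpace k ⊗[k] WSpace k} :
    t ∈ Submodule.span k {t : WSpace k ⊗[k] WSpace k |
        ∃ a ∈ Krel k r, ∃ b ∈ Krel k r, t = a ⊗ₜ[k] b} ↔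
      ∀ p p' q q', idxRel r p p' → idxRel r q q' →
        finsuppTensorFinsupp' k WIdx WIdx t (p, q) =
          finsuppTensorFinsupp' k WIdx WIdx t (p', q') := by
  classical
  constructor
  · intro ht p p' q q' hp hq
    induction ht using Submodule.span_induction with
    | mem t ht =>
      obtain ⟨a, ha, b, hb, rfl⟩ := ht
      rw [finsuppTensorFinsupp'_apply_apply, finsuppTensorFinsupp'_apply_apply,
        (mem_Krel_iff k hr hhom).1 ha _ _ hp, (mem_Krel_iff k hr hhom).1 hb _ _ hq]
    | zero => simp
    | add x y _ _ hx hy => simp [hx, hy]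
    | smul c x _ hx => simp [hx]
  · intro ht
    have key := mem_span_range_of_invariant k (prod_idxRel_equivalence hr)
      (c := fun s => finsuppTensorFinsupp' k WIdx WIdx
        (kappa r s.1.1.2 s.1.1.1 ⊗ₜ[k] kappa r s.2.1.2 s.2.1.1))
      (fun a p h => by
        rw [← Prod.mk.eta (p := p), finsuppTensorFinsupp'_apply_apply, kappa_apply k hhom,
          kappa_apply k hhom]
        exact (congrArg₂ _ (if_pos h.1) (if_pos h.2)).trans (one_mul 1))
      (fun a p h => by
        rw [← Prod.mk.eta (p := p), finsuppTensorFinsupp'_apply_apply, kappa_apply k hhom,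
          kappa_apply k hhom]
        by_cases h1 : idxRel r p.1 a.1
        · exact mul_eq_zero_of_right _ (if_neg fun h2 => h ⟨h1, h2⟩)
        · exact mul_eq_zero_of_left (if_neg h1) _)
      (finsuppTensorFinsupp' k WIdx WIdx t) (fun s s' h => ht _ _ _ _ h.1 h.2)
    have hle : Submodule.span k (Set.range fun s : WIdx × WIdx =>
        finsuppTensorFinsupp' k WIdx WIdx
          (kappa r s.1.1.2 s.1.1.1 ⊗ₜ[k] kappa r s.2.1.2 s.2.1.1)) ≤
        (Submodule.span k {t : WSpace k ⊗[k] WSpace k |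
          ∃ a ∈ Krel k r, ∃ b ∈ Krel k r, t = a ⊗ₜ[k] b}).map
          (finsuppTensorFinsupp' k WIdx WIdx).toLinearMap := by
      rw [Submodule.span_le]
      rintro _ ⟨s, rfl⟩
      exact ⟨_, Submodule.subset_span ⟨_, kappa_mem_Krel k r s.1.2, _,
        kappa_mem_Krel k r s.2.2, rfl⟩, rfl⟩
    obtain ⟨t', ht', h⟩ := hle key
    rwa [← (finsuppTensorFinsupp' k WIdx WIdx).injective h]

/-- The element `[(u ∩ {1,…,m}), m]` of `𝕎`. -/
noncomputable def lowPart (m : ℕ) (u : WIdx) : WIdx :=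
  mkIdx (intervalDown 0 m u.1.1) m fun _ ha => mem_intervalDown_le ha

/-- For `u = [w, n]`, the element `[(w ∩ {m+1,…,n}) ↓ m, n - m]` of `𝕎`. -/
noncomputable def highPart (m : ℕ) (u : WIdx) : WIdx :=
  mkIdx (intervalDown m u.1.2 u.1.1) (u.1.2 - m) fun _ ha => mem_intervalDown_le ha

open Classical in
theorem shufProd_apply (p q u : WIdx) :
    shufProd k p q u = if p.1.2 ≤ u.1.2 ∧ p = lowPart p.1.2 u ∧ q = highPart p.1.2 u
      then 1 else 0 := by
  rw [shufProd, finsum_single_apply k (P := fun u : WIdx =>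
      u.1.2 = p.1.2 + q.1.2 ∧ IsShuffle p.1.2 q.1.2 p.1.1 q.1.1 u.1.1)
    ((finite_setOf_length_eq (p.1.2 + q.1.2) (p.1.1.length + q.1.1.length)).subset
      fun u hu => ⟨hu.1, hu.2.2.2⟩)]
  congr 1
  rw [eq_iff_iff]
  have hu := u.2
  constructor
  · rintro ⟨h, hs⟩
    rw [h] at hu
    obtain ⟨h1, h2⟩ := (isShuffle_iff hu).1 hs
    rw [← h] at h2
    exact ⟨h ▸ Nat.le_add_right _ _, idx_ext h1.symm rfl, idx_ext h2.symm (by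
      change q.1.2 = u.1.2 - p.1.2
      omega)⟩
  · rintro ⟨hle, h1, h2⟩
    have hn : q.1.2 = u.1.2 - p.1.2 := congrArg (fun q : WIdx => q.1.2) h2
    have hN : u.1.2 = p.1.2 + q.1.2 := by omega
    have h1' := congrArg (fun q : WIdx => q.1.1) h1
    have h2' : q.1.1 = intervalDown p.1.2 u.1.2 u.1.1 := congrArg (fun q : WIdx => q.1.1) h2
    rw [hN] at hu h2'
    exact ⟨hN, (isShuffle_iff hu).2 ⟨h1'.symm, h2'.symm⟩⟩

theorem mulW_apply (x y : WSpace k) (u : WIdx) :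
    mulW k x y u = ∑ m ∈ Finset.range (u.1.2 + 1), x (lowPart m u) * y (highPart m u) := by
  classical
  induction x using Finsupp.induction_linear with
  | zero => simp
  | add x x' hx hx' => simp [hx, hx', add_mul, Finset.sum_add_distrib]
  | single p c =>
    induction y using Finsupp.induction_linear with
    | zero => simp
    | add y y' hy hy' => simp only [map_add, Finsupp.add_apply, hy, hy', mul_add,
        Finset.sum_add_distrib]
    | single q d =>
      have hmul : mulW k (Finsupp.single p c) (Finsupp.single q d) = c • d • shufProd k p q := by
        simp [mulW]
      rw [hmul, Finsupp.smul_apply, Finsupp.smul_apply, shufProd_apply]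
      by_cases hle : p.1.2 ≤ u.1.2
      · rw [Finset.sum_eq_single p.1.2 (fun m _ hm => ?_)
          fun h => absurd (Finset.mem_range.2 (Nat.lt_succ_of_le hle)) h]
        · simp only [Finsupp.single_apply, hle, true_and]
          by_cases h1 : p = lowPart p.1.2 u
          · by_cases h2 : q = highPart p.1.2 u
            · rw [if_pos ⟨h1, h2⟩, if_pos h1, if_pos h2, smul_eq_mul, smul_eq_mul, mul_one]
            · rw [if_neg fun h => h2 h.2, if_neg h2, smul_zero, smul_zero, mul_zero]
          · rw [if_neg fun h => h1 h.1, if_neg h1, smul_zero, smul_zero, zero_mul]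
        · rw [Finsupp.single_eq_of_ne, zero_mul]
          exact fun h => hm (congrArg (fun q : WIdx => q.1.2) h)
      · rw [if_neg fun h => hle h.1, smul_zero, smul_zero, Finset.sum_eq_zero]
        intro m hm
        rw [Finsupp.single_eq_of_ne, zero_mul]
        intro h
        have h : m = p.1.2 := congrArg (fun q : WIdx => q.1.2) h
        have := Finset.mem_range.1 hm
        omega

/-- The concatenation `[vw, n]` of `[v, n]` and `[w, n]`. -/
def concatIdx (p q : WIdx) (h : p.1.2 = q.1.2) : WIdx :=
  mkIdx (p.1.1 ++ q.1.1) p.1.2 fun a ha => (List.mem_append.1 ha).elim (p.2 a)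
    fun ha => h ▸ q.2 a ha

theorem comulW_single_apply (u : WIdx) (c : k) (p q : WIdx) :
    finsuppTensorFinsupp' k WIdx WIdx (comulW k (Finsupp.single u c)) (p, q) =
      c * ∑ i ∈ Finset.range (u.1.1.length + 1),
        Finsupp.single (mkIdx (u.1.1.take i) u.1.2
          fun a ha => u.2 a (List.take_subset i u.1.1 ha)) (1 : k) p *
        Finsupp.single (mkIdx (u.1.1.drop i) u.1.2
          fun a ha => u.2 a (List.drop_subset i u.1.1 ha)) (1 : k) q := by
  have hcomul : comulW k (Finsupp.single u c) = c • deconc k u := by simp [comulW]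
  rw [hcomul, deconc, map_smul, map_sum, Finsupp.smul_apply, Finsupp.finsetSum_apply,
    smul_eq_mul]
  congr 1
  exact Finset.sum_congr rfl fun i _ => finsuppTensorFinsupp'_apply_apply ..

theorem comulW_apply_of_eq (x : WSpace k) {p q : WIdx} (h : p.1.2 = q.1.2) :
    finsuppTensorFinsupp' k WIdx WIdx (comulW k x) (p, q) = x (concatIdx p q h) := by
  classical
  induction x using Finsupp.induction_linear with
  | zero => simp
  | add x x' hx hx' => simp [hx, hx']
  | single u c =>
    rw [comulW_single_apply]
    by_cases hu : u = concatIdx p q h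
    · have hw : u.1.1 = p.1.1 ++ q.1.1 := congrArg (fun q : WIdx => q.1.1) hu
      have hn : u.1.2 = (concatIdx p q h).1.2 := congrArg (fun q : WIdx => q.1.2) hu
      rw [← hu, Finsupp.single_eq_same, Finset.sum_eq_single p.1.1.length]
      · have h1 : mkIdx (u.1.1.take p.1.1.length) u.1.2
            (fun a ha => u.2 a (List.take_subset _ u.1.1 ha)) = p :=
          idx_ext ((congrArg (List.take p.1.1.length) hw).trans List.take_left) hn
        have h2 : mkIdx (u.1.1.drop p.1.1.length) u.1.2
            (fun a ha => u.2 a (List.drop_subset _ u.1.1 ha)) = q :=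
          idx_ext ((congrArg (List.drop p.1.1.length) hw).trans List.drop_left) (hn.trans h)
        rw [h1, h2, Finsupp.single_eq_same, Finsupp.single_eq_same, mul_one, mul_one]
      · intro i hi hne
        rw [Finsupp.single_eq_of_ne, zero_mul]
        intro h'
        have h' : p.1.1 = u.1.1.take i := congrArg (fun q : WIdx => q.1.1) h'
        have hlen := congrArg List.length h'
        rw [List.length_take] at hlen
        have := Finset.mem_range.1 hi
        omega
      · intro hlt
        rw [hw, List.length_append, Finset.mem_range] at hlt
        omega
    · rw [Finsupp.single_eq_of_ne (Ne.symm hu), Finset.sum_eq_zero, mul_zero]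
      intro i _
      rw [mul_eq_zero]
      by_contra! hne
      have h1 := not_imp_comm.1 Finsupp.single_eq_of_ne hne.1
      have h2 := not_imp_comm.1 Finsupp.single_eq_of_ne hne.2
      refine hu (idx_ext ?_ ?_)
      · change u.1.1 = p.1.1 ++ q.1.1
        rw [h1, h2]
        exact (List.take_append_drop i u.1.1).symm
      · exact (congrArg (fun q : WIdx => q.1.2) h1).symm

theorem comulW_apply_of_ne (x : WSpace k) {p q : WIdx} (h : p.1.2 ≠ q.1.2) :
    finsuppTensorFinsupp' k WIdx WIdx (comulW k x) (p, q) = 0 := by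
  classical
  induction x using Finsupp.induction_linear with
  | zero => simp
  | add x x' hx hx' => simp [hx, hx']
  | single u c =>
    rw [comulW_single_apply, Finset.sum_eq_zero, mul_zero]
    intro i _
    rw [mul_eq_zero]
    by_contra! hne
    have h1 := not_imp_comm.1 Finsupp.single_eq_of_ne hne.1
    have h2 := not_imp_comm.1 Finsupp.single_eq_of_ne hne.2
    exact h ((congrArg (fun q : WIdx => q.1.2) h1).trans
      (congrArg (fun q : WIdx => q.1.2) h2).symm)

theorem unitW_mem_Krel {r : Word → Word → Prop} (hr : Equivalence r) (hhom : IsHomogeneous r) :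
    unitW k ∈ Krel k r := by
  rw [mem_Krel_iff k hr hhom]
  intro p q hpq
  have hunit : unitW k = Finsupp.single (mkIdx [] 0 (by simp)) 1 := rfl
  have key : ∀ p q, idxRel r p q → p = mkIdx [] 0 (by simp) → q = mkIdx [] 0 (by simp) := by
    rintro p q ⟨h1, h2⟩ rfl
    exact idx_ext (List.length_eq_zero_iff.1 (hhom _ _ h2).symm) h1.symm
  rw [hunit]
  by_cases hp : p = mkIdx [] 0 (by simp)
  · rw [hp, key p q hpq hp]
  · rw [Finsupp.single_eq_of_ne hp, Finsupp.single_eq_of_ne fun hq =>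
      hp (key q p ((idxRel_equivalence hr).symm hpq) hq)]

theorem mulW_mem_Krel {r : Word → Word → Prop} (hr : IsAlgebraicRel r) (hhom : IsHomogeneous r)
    {x y : WSpace k} (hx : x ∈ Krel k r) (hy : y ∈ Krel k r) : mulW k x y ∈ Krel k r := by
  rw [mem_Krel_iff k hr.equiv hhom] at hx hy ⊢
  intro u u' h
  rw [mulW_apply, mulW_apply, h.1]
  refine Finset.sum_congr rfl fun m _ => ?_
  rw [hx (lowPart m u) (lowPart m u') ⟨rfl, hr.restrict _ _ h.2 _ _⟩,
    hy (highPart m u) (highPart m u')]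
  refine ⟨congrArg (· - m) h.1, ?_⟩
  simp only [highPart, h.1]
  exact hr.restrict _ _ h.2 _ _

theorem comulW_mem {r : Word → Word → Prop} (hr : IsAlgebraicRel r) (hhom : IsHomogeneous r)
    {x : WSpace k} (hx : x ∈ Krel k r) :
    comulW k x ∈ Submodule.span k {t : WSpace k ⊗[k] WSpace k |
      ∃ a ∈ Krel k r, ∃ b ∈ Krel k r, t = a ⊗ₜ[k] b} := by
  rw [mem_Krel_tensor_iff k hr.equiv hhom]
  rw [mem_Krel_iff k hr.equiv hhom] at hx
  intro p p' q q' hp hq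
  by_cases h : p.1.2 = q.1.2
  · rw [comulW_apply_of_eq k x h, comulW_apply_of_eq k x (hp.1.symm.trans (h.trans hq.1))]
    exact hx _ _ ⟨hp.1, hr.concat _ _ _ _ hp.2 hq.2⟩
  · rw [comulW_apply_of_ne k x h,
      comulW_apply_of_ne k x fun h' => h (hp.1.trans (h'.trans hq.1.symm))]

theorem IsWordRel.forall_le {r : Word → Word → Prop} (hrel : IsWordRel r) {v w : Word}
    (h : r v w) {n : ℕ} (hv : ∀ a ∈ v, (a : ℕ) ≤ n) : ∀ a ∈ w, (a : ℕ) ≤ n := by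
  intro a ha
  have hs : v.toFinset = w.toFinset := hrel.letters v w h
  exact hv a (List.mem_toFinset.1 (hs ▸ List.mem_toFinset.2 ha))

theorem exists_forall_le (w : Word) : ∃ n : ℕ, ∀ a ∈ w, (a : ℕ) ≤ n :=
  ⟨(w.map PNat.val).sum, fun _ ha => List.le_sum_of_mem (List.mem_map_of_mem ha)⟩

theorem restrict_of_mulW_mem {r : Word → Word → Prop} (hrel : IsWordRel r)
    (hhom : IsHomogeneous r)
    (hmul : ∀ x ∈ Krel k r, ∀ y ∈ Krel k r, mulW k x y ∈ Krel k r)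
    {v w : Word} (h : r v w) {m n : ℕ} (hmn : m ≤ n) (hv : ∀ a ∈ v, (a : ℕ) ≤ n) :
    r (intervalDown 0 m v) (intervalDown 0 m w) ∧
      r (intervalDown m n v) (intervalDown m n w) := by
  classical
  have hw := hrel.forall_le h hv
  have hx := hmul _ (kappa_mem_Krel k r (lowPart m (mkIdx v n hv)).2)
    _ (kappa_mem_Krel k r (highPart m (mkIdx v n hv)).2)
  have heq := (mem_Krel_iff k hrel.equiv hhom).1 hx (mkIdx v n hv) (mkIdx w n hw) ⟨rfl, h⟩
  have hsum : ∀ u : WIdx, u.1.2 = n → mulW k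
      (kappa r (lowPart m (mkIdx v n hv)).1.2 (lowPart m (mkIdx v n hv)).1.1)
      (kappa r (highPart m (mkIdx v n hv)).1.2 (highPart m (mkIdx v n hv)).1.1) u =
      (if idxRel r (lowPart m u) (lowPart m (mkIdx v n hv)) then 1 else 0) *
        (if idxRel r (highPart m u) (highPart m (mkIdx v n hv)) then 1 else 0) := by
    intro u hu
    rw [mulW_apply, Finset.sum_eq_single m]
    · rw [kappa_apply k hhom, kappa_apply k hhom]
      congr
    · intro m' _ hm'
      rw [kappa_apply k hhom, if_neg fun hh => hm' hh.1, zero_mul]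
    · intro hm'
      rw [hu, Finset.mem_range] at hm'
      omega
  rw [hsum _ rfl, hsum _ rfl, if_pos ((idxRel_equivalence hrel.equiv).refl _),
    if_pos ((idxRel_equivalence hrel.equiv).refl _), one_mul] at heq
  by_contra hne
  by_cases h1 : idxRel r (lowPart m (mkIdx w n hw)) (lowPart m (mkIdx v n hv))
  · rw [if_pos h1, one_mul,
      if_neg fun h2 => hne ⟨hrel.equiv.symm h1.2, hrel.equiv.symm h2.2⟩] at heq
    exact one_ne_zero heq
  · rw [if_neg h1, zero_mul] at heq
    exact one_ne_zero heq

theorem concat_of_comulW_mem {r : Word → Word → Prop} (hrel : IsWordRel r)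
    (hhom : IsHomogeneous r)
    (hcomul : ∀ x ∈ Krel k r, comulW k x ∈
      Submodule.span k {t : WSpace k ⊗[k] WSpace k |
        ∃ a ∈ Krel k r, ∃ b ∈ Krel k r, t = a ⊗ₜ[k] b})
    {v v' w w' : Word} (hv : r v v') (hw : r w w') : r (v ++ w) (v' ++ w') := by
  classical
  obtain ⟨n, hn⟩ := exists_forall_le (v ++ w)
  have hvn : ∀ a ∈ v, (a : ℕ) ≤ n := fun a ha => hn a (by simp [ha])
  have hwn : ∀ a ∈ w, (a : ℕ) ≤ n := fun a ha => hn a (by simp [ha])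
  have heq := (mem_Krel_tensor_iff k hrel.equiv hhom).1 (hcomul _ (kappa_mem_Krel k r hn))
    (mkIdx v n hvn) (mkIdx v' n (hrel.forall_le hv hvn)) (mkIdx w n hwn)
    (mkIdx w' n (hrel.forall_le hw hwn)) ⟨rfl, hv⟩ ⟨rfl, hw⟩
  rw [comulW_apply_of_eq k _ (p := mkIdx v n hvn) (q := mkIdx w n hwn) rfl,
    comulW_apply_of_eq k _ (p := mkIdx v' n _) (q := mkIdx w' n _) rfl, kappa_apply k hhom,
    kappa_apply k hhom, if_pos ⟨rfl, hrel.equiv.refl _⟩] at heq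
  by_contra hne
  rw [if_neg fun hh => hne (hrel.equiv.symm hh.2)] at heq
  exact one_ne_zero heq

theorem stmt8 (r : Word → Word → Prop) (hrel : IsWordRel r) (hhom : IsHomogeneous r) :
    -- `K^(~)` is a graded sub-bialgebra of `W` iff `~` is algebraic
    ((unitW k ∈ Krel k r ∧
      (∀ x ∈ Krel k r, ∀ y ∈ Krel k r, mulW k x y ∈ Krel k r) ∧
      (∀ x ∈ Krel k r, comulW k x ∈
        Submodule.span k {t : WSpace k ⊗[k] WSpace k |
          ∃ a ∈ Krel k r, ∃ b ∈ Krel k r, t = a ⊗ₜ[k] b})) ↔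
    IsAlgebraicRel r) := by
  constructor
  · rintro ⟨-, hmul, hcomul⟩
    refine ⟨hrel, fun v v' w w' => concat_of_comulW_mem k hrel hhom hcomul, fun v w h m n => ?_⟩
    rcases le_or_gt n m with hnm | hmn
    · rw [intervalDown_eq_nil_of_le hnm, intervalDown_eq_nil_of_le hnm]
      exact hrel.equiv.refl _
    · obtain ⟨N, hN⟩ := exists_forall_le v
      have hlow := (restrict_of_mulW_mem k hrel hhom hmul h (le_max_left n N)
        fun a ha => (hN a ha).trans (le_max_right n N)).1
      have := (restrict_of_mulW_mem k hrel hhom hmul hlow hmn.le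
        fun _ ha => mem_intervalDown_le ha).2
      rwa [intervalDown_intervalDown_zero, intervalDown_intervalDown_zero] at this
  · intro hr
    exact ⟨unitW_mem_Krel k hrel.equiv hhom, fun x hx y hy => mulW_mem_Krel k hr hhom hx hy,
      fun x hx => comulW_mem k hr hhom hx⟩
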